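/- Fix p ≥ 1 and define φ_p(t) := |t| for |t| ≤ 1 and φ_p(t) := |t|^p for |t| > 1. Let P and (P_l)_{l∈ℕ} be Borel probability measures on ℝ with ∫|t|^p dP < ∞ and ∫|t|^p dP_l < ∞ for all l. Then d_{FM,p}(P_l, P) → 0 as l → ∞ if and only if P_l converges weakly to P and ∫_ℝ φ_p dP_l → ∫_ℝ φ_p dP. -/

import Mathlib

open MeasureTheory
open scoped ENNReal

/-- The `p`-th order Fortet–Mourier distance between Borel probability measures on `ℝ`. -/
noncomputable def dFM (p : ℝ) (P Q : Measure ℝ) : ℝ≥0∞ :=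
  ⨆ ψ ∈ {ψ : ℝ → ℝ | ∀ x y : ℝ, |ψ x - ψ y| ≤ max 1 (max |x| |y|) ^ (p - 1) * |x - y|},
    ENNReal.ofReal |∫ x, ψ x ∂P - ∫ x, ψ x ∂Q|

open Filter Topology Set
open scoped BoundedContinuousFunction NNReal

/-- The class of test functions of the `p`-th order Fortet–Mourier distance. -/
def fortetMourierClass (p : ℝ) : Set (ℝ → ℝ) :=
  {ψ | ∀ x y : ℝ, |ψ x - ψ y| ≤ max 1 (max |x| |y|) ^ (p - 1) * |x - y|}

/-- The growth function `φ_p`, written as a single formula. -/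
noncomputable def growthWeight (p t : ℝ) : ℝ := max 1 |t| ^ (p - 1) * |t|

lemma growthWeight_eq_ite (p t : ℝ) :
    growthWeight p t = if |t| ≤ 1 then |t| else |t| ^ p := by
  unfold growthWeight
  split_ifs with h
  · simp [max_eq_left h]
  · have h : 1 < |t| := not_le.1 h
    rw [max_eq_right h.le, Real.rpow_sub_one (by positivity),
      div_mul_cancel₀ _ (by positivity)]

lemma growthWeight_of_one_le {p t : ℝ} (h : 1 ≤ |t|) : growthWeight p t = |t| ^ p := by
  rw [growthWeight, max_eq_right h, Real.rpow_sub_one (by positivity),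
    div_mul_cancel₀ _ (by positivity)]

lemma growthWeight_nonneg (p t : ℝ) : 0 ≤ growthWeight p t := by
  unfold growthWeight; positivity

lemma continuous_growthWeight (p : ℝ) : Continuous (growthWeight p) := by
  unfold growthWeight
  refine Continuous.mul (Continuous.rpow_const (by fun_prop) fun x => Or.inl ?_) (by fun_prop)
  positivity

lemma integrable_growthWeight {p : ℝ} {Q : Measure ℝ} [IsFiniteMeasure Q]
    (hQ : Integrable (fun t : ℝ => |t| ^ p) Q) : Integrable (growthWeight p) Q := by
  refine ((integrable_const (1 : ℝ)).add hQ).mono'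
    (continuous_growthWeight p).aestronglyMeasurable (ae_of_all _ fun t => ?_)
  rw [Real.norm_of_nonneg (growthWeight_nonneg p t), growthWeight_eq_ite]
  have := Real.rpow_nonneg (abs_nonneg t) p
  simp only [Pi.add_apply]
  split_ifs <;> linarith

/-- The tangent line inequality for `x ↦ x ^ p`. -/
lemma Real.rpow_sub_rpow_le {p a b : ℝ} (hp : 1 ≤ p) (ha : 0 ≤ a) (hb : 0 < b) :
    b ^ p - a ^ p ≤ p * b ^ (p - 1) * (b - a) := by
  have h := one_add_mul_self_le_rpow_one_add (s := a / b - 1)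
    (by linarith [div_nonneg ha hb.le]) hp
  rw [add_sub_cancel, Real.div_rpow ha hb.le, le_div_iff₀ (by positivity)] at h
  have e : b ^ p = b ^ (p - 1) * b := by
    rw [Real.rpow_sub_one hb.ne', div_mul_cancel₀ _ hb.ne']
  have e2 : p * (a / b - 1) * b ^ p = p * b ^ (p - 1) * (a - b) := by
    rw [e]; field_simp
  linarith

lemma growthWeight_sub_le {p x y : ℝ} (hp : 1 ≤ p) (h : |y| ≤ |x|) :
    growthWeight p x - growthWeight p y ≤ p * max 1 |x| ^ (p - 1) * (|x| - |y|) := by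
  rcases le_or_gt |x| 1 with hx | hx
  · simp only [growthWeight, max_eq_left hx, max_eq_left (h.trans hx), Real.one_rpow]
    nlinarith
  · rw [growthWeight_of_one_le hx.le, max_eq_right hx.le]
    rcases le_or_gt |y| 1 with hy | hy
    · have h1 := Real.rpow_sub_rpow_le hp zero_le_one (zero_lt_one.trans hx)
      have h2 : 1 ≤ |x| ^ (p - 1) := Real.one_le_rpow hx.le (by linarith)
      have h3 : 1 ≤ p * |x| ^ (p - 1) := by nlinarith
      rw [Real.one_rpow] at h1
      simp only [growthWeight, max_eq_left hy, Real.one_rpow]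
      nlinarith
    · rw [growthWeight_of_one_le hy.le]
      exact Real.rpow_sub_rpow_le hp (abs_nonneg y) (by linarith)

lemma growthWeight_mono {p x y : ℝ} (hp : 1 ≤ p) (h : |y| ≤ |x|) :
    growthWeight p y ≤ growthWeight p x := by
  unfold growthWeight
  have : 0 ≤ p - 1 := by linarith
  gcongr

lemma abs_growthWeight_sub_le {p : ℝ} (hp : 1 ≤ p) (x y : ℝ) :
    |growthWeight p x - growthWeight p y| ≤
      p * (max 1 (max |x| |y|) ^ (p - 1) * |x - y|) := by
  wlog h : |y| ≤ |x| generalizing x y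
  · have := this y x (le_of_not_ge h)
    rwa [abs_sub_comm, max_comm |x|, abs_sub_comm x]
  · rw [abs_of_nonneg (sub_nonneg.2 (growthWeight_mono hp h)), max_eq_left h, ← mul_assoc]
    refine (growthWeight_sub_le hp h).trans ?_
    have := abs_sub_abs_le_abs_sub x y
    gcongr

lemma growthWeight_div_mem {p : ℝ} (hp : 1 ≤ p) :
    (fun t => growthWeight p t / p) ∈ fortetMourierClass p := by
  intro x y
  have hp0 : 0 < p := by linarith
  rw [← sub_div, abs_div, abs_of_pos hp0, div_le_iff₀ hp0, mul_comm _ p]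
  exact abs_growthWeight_sub_le hp x y

lemma LipschitzWith.div_mem_fortetMourierClass {p : ℝ} (hp : 1 ≤ p) {L : ℝ≥0} {f : ℝ → ℝ}
    (hf : LipschitzWith L f) : (fun t => f t / (L + 1)) ∈ fortetMourierClass p := by
  intro x y
  have hL : (0 : ℝ) < L + 1 := by positivity
  have h1 : 1 ≤ max 1 (max |x| |y|) ^ (p - 1) :=
    Real.one_le_rpow (le_max_left _ _) (by linarith)
  have h2 : |f x - f y| ≤ L * |x - y| := by simpa [Real.dist_eq] using hf.dist_le_mul x y
  rw [← sub_div, abs_div, abs_of_pos hL, div_le_iff₀ hL]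
  have h3 : |x - y| ≤ max 1 (max |x| |y|) ^ (p - 1) * |x - y| :=
    le_mul_of_one_le_left (abs_nonneg _) h1
  nlinarith [abs_nonneg (x - y), L.coe_nonneg]

lemma ofReal_abs_integral_sub_le_dFM {p : ℝ} (P Q : Measure ℝ) {ψ : ℝ → ℝ}
    (hψ : ψ ∈ fortetMourierClass p) :
    ENNReal.ofReal |∫ x, ψ x ∂P - ∫ x, ψ x ∂Q| ≤ dFM p P Q :=
  le_iSup₂_of_le (f := fun (ψ : ℝ → ℝ) (_ : ψ ∈ fortetMourierClass p) =>
    ENNReal.ofReal |∫ x, ψ x ∂P - ∫ x, ψ x ∂Q|) ψ hψ le_rfl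

lemma tendsto_integral_of_tendsto_dFM {p : ℝ} {P : Measure ℝ} {Pl : ℕ → Measure ℝ}
    (h : Tendsto (fun l => dFM p (Pl l) P) atTop (𝓝 0)) {f : ℝ → ℝ} {c : ℝ} (hc : c ≠ 0)
    (hf : (fun t => f t / c) ∈ fortetMourierClass p) :
    Tendsto (fun l => ∫ x, f x ∂(Pl l)) atTop (𝓝 (∫ x, f x ∂P)) := by
  have h1 : Tendsto (fun l => ∫ x, f x / c ∂(Pl l)) atTop (𝓝 (∫ x, f x / c ∂P)) := by
    rw [tendsto_iff_dist_tendsto_zero]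
    have h2 := tendsto_of_tendsto_of_tendsto_of_le_of_le tendsto_const_nhds h
      (fun l => zero_le) (fun l => ofReal_abs_integral_sub_le_dFM (Pl l) P hf)
    have h3 := (ENNReal.tendsto_toReal ENNReal.zero_ne_top).comp h2
    simpa [Function.comp_def, Real.dist_eq, ENNReal.toReal_ofReal] using h3
  simpa [integral_div, div_mul_cancel₀ _ hc] using h1.mul_const c

/-- Weak convergence is uniform over uniformly bounded and uniformly Lipschitz functions that are
extended constantly from a compact interval. -/
lemma eventually_forall_lipschitz_abs_integral_sub_le {P : Measure ℝ} {Pl : ℕ → Measure ℝ}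
    [IsProbabilityMeasure P] [∀ l, IsProbabilityMeasure (Pl l)]
    (hw : ∀ f : ℝ → ℝ, Continuous f → (∃ C : ℝ, ∀ x, |f x| ≤ C) →
      Tendsto (fun l => ∫ x, f x ∂(Pl l)) atTop (𝓝 (∫ x, f x ∂P)))
    {a b : ℝ} (hab : a ≤ b) (L : ℝ≥0) (M : ℝ) {ε : ℝ} (hε : 0 < ε) :
    ∀ᶠ l in atTop, ∀ g : Icc a b → ℝ, LipschitzWith L g → (∀ x, |g x| ≤ M) →
      |∫ x, IccExtend hab g x ∂(Pl l) - ∫ x, IccExtend hab g x ∂P| ≤ ε := by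
  set A : Set (Icc a b →ᵇ ℝ) := {f | LipschitzWith L f ∧ ∀ x, |f x| ≤ M}
  have hA : IsCompact (closure A) := by
    refine BoundedContinuousFunction.arzela_ascoli (Icc (-M) M) isCompact_Icc A
      (fun f x hf => abs_le.1 (hf.2 x)) ?_
    exact (LipschitzWith.uniformEquicontinuous _ L fun f => f.2.1).equicontinuous
  obtain ⟨t, -, htf, ht⟩ :=
    exists_finite_cover_balls_of_isCompact_closure hA (ε := ε / 3) (by positivity)
  have hcont (f : Icc a b →ᵇ ℝ) : Continuous (IccExtend hab f) := f.continuous.Icc_extend'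
  have hint (f : Icc a b →ᵇ ℝ) (Q : Measure ℝ) [IsProbabilityMeasure Q] :
      Integrable (IccExtend hab f) Q :=
    (integrable_const ‖f‖).mono' (hcont f).aestronglyMeasurable
      (ae_of_all _ fun x => f.norm_coe_le_norm _)
  have hclose (f g : Icc a b →ᵇ ℝ) (Q : Measure ℝ) [IsProbabilityMeasure Q] :
      |∫ x, IccExtend hab f x ∂Q - ∫ x, IccExtend hab g x ∂Q| ≤ dist f g := by
    rw [← integral_sub (hint f Q) (hint g Q), ← Real.norm_eq_abs]
    refine (norm_integral_le_of_norm_le_const (C := dist f g) (ae_of_all _ fun x => ?_)).trans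
      (by simp)
    exact BoundedContinuousFunction.dist_coe_le_dist (f := f) (g := g) _
  have hfin : ∀ᶠ l in atTop, ∀ f ∈ t,
      |∫ x, IccExtend hab f x ∂(Pl l) - ∫ x, IccExtend hab f x ∂P| < ε / 3 := by
    refine (eventually_all_finite htf).2 fun f _ => ?_
    have := hw _ (hcont f) ⟨‖f‖, fun x => f.norm_coe_le_norm _⟩
    exact (Metric.tendsto_nhds.1 this) (ε / 3) (by positivity)
  filter_upwards [hfin] with l hl g hgL hgM
  obtain ⟨G, hG⟩ : ∃ G : Icc a b →ᵇ ℝ, ⇑G = g :=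
    ⟨BoundedContinuousFunction.mkOfCompact ⟨g, hgL.continuous⟩, rfl⟩
  have hGA : G ∈ A := ⟨hG ▸ hgL, hG ▸ hgM⟩
  obtain ⟨f, hft, hf⟩ := mem_iUnion₂.1 (ht hGA)
  rw [← hG]
  have h1 := abs_le.1 (hclose G f (Pl l))
  have h2 := abs_le.1 (hclose G f P)
  have h3 := abs_lt.1 (hl f hft)
  have h4 : dist G f < ε / 3 := hf
  rw [abs_le]
  constructor <;> linarith

/-- Truncation of the real line to `[-R, R]`. -/
noncomputable def truncate (R x : ℝ) : ℝ := max (-R) (min R x)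

lemma continuous_truncate (R : ℝ) : Continuous (truncate R) := by
  unfold truncate; fun_prop

lemma truncate_of_abs_le {R x : ℝ} (h : |x| ≤ R) : truncate R x = x := by
  rw [abs_le] at h
  rw [truncate, min_eq_right h.2, max_eq_right h.1]

lemma abs_truncate {R x : ℝ} (h : R < |x|) (hR : 0 ≤ R) : |truncate R x| = R := by
  unfold truncate
  rcases lt_abs.1 h with h | h
  · rw [min_eq_left h.le, max_eq_right (by linarith), abs_of_nonneg hR]
  · rw [min_eq_right (by linarith), max_eq_left (by linarith), abs_neg, abs_of_nonneg hR]

lemma abs_sub_truncate {R x : ℝ} (h : R < |x|) (hR : 0 ≤ R) : |x - truncate R x| = |x| - R := by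
  unfold truncate
  rcases lt_abs.1 h with h | h
  · rw [min_eq_left h.le, max_eq_right (by linarith), abs_of_pos (by linarith),
      abs_of_pos (by linarith)]
  · rw [min_eq_right (by linarith), max_eq_left (by linarith), abs_of_neg (by linarith),
      abs_of_neg (by linarith)]
    ring

lemma abs_truncate_le_abs {R : ℝ} (hR : 0 ≤ R) (x : ℝ) : |truncate R x| ≤ |x| := by
  rcases le_or_gt |x| R with h | h
  · rw [truncate_of_abs_le h]
  · rw [abs_truncate h hR]; exact h.le

lemma abs_truncate_le {R : ℝ} (hR : 0 ≤ R) (x : ℝ) : |truncate R x| ≤ R := by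
  rcases le_or_gt |x| R with h | h
  · rwa [truncate_of_abs_le h]
  · rw [abs_truncate h hR]

lemma abs_sub_truncate_le {p R : ℝ} (hp : 1 ≤ p) (hR : 1 ≤ R) {ψ : ℝ → ℝ}
    (hψ : ψ ∈ fortetMourierClass p) (x : ℝ) :
    |ψ x - ψ (truncate R x)| ≤ growthWeight p x - growthWeight p (truncate R x) := by
  have hR0 : 0 ≤ R := by linarith
  rcases le_or_gt |x| R with h | h
  · simp [truncate_of_abs_le h]
  · refine (hψ _ _).trans ?_
    rw [max_eq_left (abs_truncate_le_abs hR0 x), abs_sub_truncate h hR0]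
    simp only [growthWeight, abs_truncate h hR0]
    have : max 1 R ^ (p - 1) ≤ max 1 |x| ^ (p - 1) := by
      have : 0 ≤ p - 1 := by linarith
      gcongr
    nlinarith

lemma abs_sub_zero_le_growthWeight {p : ℝ} {ψ : ℝ → ℝ} (hψ : ψ ∈ fortetMourierClass p) (x : ℝ) :
    |ψ x - ψ 0| ≤ growthWeight p x := by
  simpa [growthWeight] using hψ x 0

lemma lipschitzOnWith_of_mem_fortetMourierClass {p R : ℝ} (hp : 1 ≤ p) (hR : 1 ≤ R) {ψ : ℝ → ℝ}
    (hψ : ψ ∈ fortetMourierClass p) :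
    LipschitzOnWith (R ^ (p - 1)).toNNReal ψ (Icc (-R) R) := by
  refine LipschitzOnWith.of_dist_le_mul fun x hx y hy => ?_
  rw [Real.coe_toNNReal _ (Real.rpow_nonneg (by linarith) _), Real.dist_eq, Real.dist_eq]
  refine (hψ x y).trans ?_
  have : 0 ≤ p - 1 := by linarith
  gcongr
  exact max_le hR (max_le (abs_le.2 hx) (abs_le.2 hy))

lemma continuous_of_mem_fortetMourierClass {p : ℝ} (hp : 1 ≤ p) {ψ : ℝ → ℝ}
    (hψ : ψ ∈ fortetMourierClass p) : Continuous ψ := by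
  refine continuous_iff_continuousAt.2 fun x => ?_
  refine (lipschitzOnWith_of_mem_fortetMourierClass hp (R := |x| + 1)
    (by linarith [abs_nonneg x]) hψ).continuousOn.continuousAt (Icc_mem_nhds ?_ ?_)
  · linarith [neg_abs_le x]
  · linarith [le_abs_self x]

lemma integrable_growthWeight_truncate {p R : ℝ} (hp : 1 ≤ p) (hR : 0 ≤ R) {Q : Measure ℝ}
    (hQ : Integrable (growthWeight p) Q) :
    Integrable (fun x => growthWeight p (truncate R x)) Q := by
  refine hQ.mono' ((continuous_growthWeight p).comp
    (continuous_truncate R)).aestronglyMeasurable (ae_of_all _ fun x => ?_)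
  rw [Real.norm_of_nonneg (growthWeight_nonneg _ _)]
  exact growthWeight_mono hp (abs_truncate_le_abs hR x)

lemma tendsto_integral_growthWeight_truncate {p : ℝ} (hp : 1 ≤ p) {Q : Measure ℝ}
    (hQ : Integrable (growthWeight p) Q) :
    Tendsto (fun n : ℕ => ∫ x, growthWeight p (truncate n x) ∂Q) atTop
      (𝓝 (∫ x, growthWeight p x ∂Q)) := by
  refine tendsto_integral_of_dominated_convergence (growthWeight p)
    (fun n => ((continuous_growthWeight p).comp (continuous_truncate n)).aestronglyMeasurable)
    hQ (fun n => ae_of_all _ fun x => ?_) (ae_of_all _ fun x => ?_)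
  · rw [Real.norm_of_nonneg (growthWeight_nonneg _ _)]
    exact growthWeight_mono hp (abs_truncate_le_abs n.cast_nonneg x)
  · refine tendsto_const_nhds.congr' ?_
    filter_upwards [eventually_ge_atTop ⌈|x|⌉₊] with n hn
    rw [truncate_of_abs_le (Nat.ceil_le.1 hn)]

/-- Replacing a test function by its truncation costs at most the tail of the growth function. -/
lemma abs_integral_sub_integral_truncate_le {p R : ℝ} (hp : 1 ≤ p) (hR : 1 ≤ R) {Q : Measure ℝ}
    [IsProbabilityMeasure Q] (hQ : Integrable (growthWeight p) Q) {ψ : ℝ → ℝ}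
    (hψ : ψ ∈ fortetMourierClass p) :
    |∫ x, ψ x ∂Q - ψ 0 - ∫ x, (ψ (truncate R x) - ψ 0) ∂Q| ≤
      ∫ x, growthWeight p x ∂Q - ∫ x, growthWeight p (truncate R x) ∂Q := by
  have hR0 : 0 ≤ R := by linarith
  have hc := continuous_of_mem_fortetMourierClass hp hψ
  have hi1 : Integrable (fun x => ψ x - ψ 0) Q :=
    hQ.mono' (hc.sub continuous_const).aestronglyMeasurable
      (ae_of_all _ (abs_sub_zero_le_growthWeight hψ))
  have hi2 : Integrable (fun x => ψ (truncate R x) - ψ 0) Q :=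
    (integrable_growthWeight_truncate hp hR0 hQ).mono'
      ((hc.comp (continuous_truncate R)).sub continuous_const).aestronglyMeasurable
      (ae_of_all _ fun x => abs_sub_zero_le_growthWeight hψ _)
  have hi3 : Integrable ψ Q :=
    (hi1.add (integrable_const (ψ 0))).congr (ae_of_all _ fun x => sub_add_cancel _ _)
  have e : ∫ x, ψ x ∂Q - ψ 0 = ∫ x, (ψ x - ψ 0) ∂Q := by
    rw [integral_sub hi3 (integrable_const _)]; simp
  rw [e, ← integral_sub hi1 hi2, ← integral_sub hQ (integrable_growthWeight_truncate hp hR0 hQ),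
    ← Real.norm_eq_abs]
  refine norm_integral_le_of_norm_le (hQ.sub (integrable_growthWeight_truncate hp hR0 hQ))
    (ae_of_all _ fun x => ?_)
  rw [sub_sub_sub_cancel_right]
  exact abs_sub_truncate_le hp hR hψ x

lemma tendsto_dFM_zero {p : ℝ} (hp : 1 ≤ p) {P : Measure ℝ} {Pl : ℕ → Measure ℝ}
    [IsProbabilityMeasure P] [∀ l, IsProbabilityMeasure (Pl l)]
    (hP : Integrable (growthWeight p) P) (hPl : ∀ l, Integrable (growthWeight p) (Pl l))
    (hw : ∀ f : ℝ → ℝ, Continuous f → (∃ C : ℝ, ∀ x, |f x| ≤ C) →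
      Tendsto (fun l => ∫ x, f x ∂(Pl l)) atTop (𝓝 (∫ x, f x ∂P)))
    (hφ : Tendsto (fun l => ∫ x, growthWeight p x ∂(Pl l)) atTop
      (𝓝 (∫ x, growthWeight p x ∂P))) :
    Tendsto (fun l => dFM p (Pl l) P) atTop (𝓝 0) := by
  have key : ∀ ε : ℝ, 0 < ε → ∀ᶠ l in atTop, dFM p (Pl l) P ≤ ENNReal.ofReal ε := by
    intro ε hε
    obtain ⟨R, hR, hn⟩ : ∃ R : ℝ, 1 ≤ R ∧
        ∫ x, growthWeight p x ∂P - ∫ x, growthWeight p (truncate R x) ∂P < ε / 3 := by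
      have h := (tendsto_integral_growthWeight_truncate hp hP).const_sub
        (∫ x, growthWeight p x ∂P)
      rw [sub_self] at h
      obtain ⟨n, hn1, hn⟩ :=
        ((eventually_ge_atTop 1).and (h.eventually_lt_const (by positivity : 0 < ε / 3))).exists
      exact ⟨n, by exact_mod_cast hn1, hn⟩
    have hR0 : 0 ≤ R := by linarith
    have hRR : -R ≤ R := by linarith
    have hwt (x : ℝ) : growthWeight p (truncate R x) ≤ growthWeight p R :=
      growthWeight_mono hp ((abs_truncate_le hR0 x).trans (le_abs_self R))
    have htail : ∀ᶠ l in atTop,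
        ∫ x, growthWeight p x ∂(Pl l) - ∫ x, growthWeight p (truncate R x) ∂(Pl l) < ε / 3 := by
      refine (hφ.sub (hw _ ((continuous_growthWeight p).comp (continuous_truncate R))
        ⟨growthWeight p R, fun x => ?_⟩)).eventually_lt_const hn
      rw [Function.comp_apply, abs_of_nonneg (growthWeight_nonneg _ _)]
      exact hwt x
    filter_upwards [htail, eventually_forall_lipschitz_abs_integral_sub_le hw hRR
      (R ^ (p - 1)).toNNReal (growthWeight p R) (show 0 < ε / 3 by positivity)] with l hl hlip
    refine iSup₂_le fun ψ (hψ : ψ ∈ fortetMourierClass p) => ENNReal.ofReal_le_ofReal ?_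
    have h1 := abs_le.1 (abs_integral_sub_integral_truncate_le hp hR (hPl l) hψ)
    have h2 := abs_le.1 (abs_integral_sub_integral_truncate_le hp hR hP hψ)
    have h3 : |∫ x, (ψ (truncate R x) - ψ 0) ∂(Pl l) - ∫ x, (ψ (truncate R x) - ψ 0) ∂P|
        ≤ ε / 3 := by
      refine hlip (fun x => ψ x - ψ 0) ?_ fun x => ?_
      · refine LipschitzWith.of_dist_le_mul fun x y => ?_
        rw [dist_sub_right]
        exact (lipschitzOnWith_of_mem_fortetMourierClass hp hR hψ).dist_le_mul x x.2 y y.2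
      · exact (abs_sub_zero_le_growthWeight hψ x).trans
          (growthWeight_mono hp ((abs_le.2 x.2).trans (le_abs_self R)))
    rw [abs_le] at h3 ⊢
    constructor <;> linarith
  refine ENNReal.tendsto_nhds_zero.2 fun ε hε => ?_
  rcases eq_or_ne ε ⊤ with rfl | htop
  · simp
  · simpa [ENNReal.ofReal_toReal htop] using key ε.toReal (ENNReal.toReal_pos hε.ne' htop)

/-- Fix `p ≥ 1` and `φ_p(t) = |t|` for `|t| ≤ 1`, `φ_p(t) = |t|^p`
otherwise. For probability measures `P, (P_l)` on `ℝ` with finite `p`-th absolute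
moments, `d_{FM,p}(P_l, P) → 0` iff `P_l → P` weakly and `∫ φ_p dP_l → ∫ φ_p dP`. -/
theorem fortetMourier_tendsto_iff_weak_and_phi (p : ℝ) (hp : 1 ≤ p)
    (P : Measure ℝ) (Pl : ℕ → Measure ℝ)
    [IsProbabilityMeasure P] [∀ l, IsProbabilityMeasure (Pl l)]
    (hP : Integrable (fun t : ℝ => |t| ^ p) P)
    (hPl : ∀ l, Integrable (fun t : ℝ => |t| ^ p) (Pl l)) :
    Filter.Tendsto (fun l => dFM p (Pl l) P) Filter.atTop (nhds 0) ↔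
      ((∀ f : ℝ → ℝ, Continuous f → (∃ C : ℝ, ∀ x, |f x| ≤ C) →
        Filter.Tendsto (fun l => ∫ x, f x ∂(Pl l)) Filter.atTop (nhds (∫ x, f x ∂P))) ∧
      Filter.Tendsto (fun l => ∫ t, (if |t| ≤ 1 then |t| else |t| ^ p) ∂(Pl l))
        Filter.atTop (nhds (∫ t, (if |t| ≤ 1 then |t| else |t| ^ p) ∂P))) := by
  simp_rw [← growthWeight_eq_ite]
  refine ⟨fun h => ⟨?_, ?_⟩, fun h => tendsto_dFM_zero hp (integrable_growthWeight hP)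
    (fun l => integrable_growthWeight (hPl l)) h.1 h.2⟩
  · let Q : ProbabilityMeasure ℝ := ⟨P, inferInstance⟩
    let Ql : ℕ → ProbabilityMeasure ℝ := fun l => ⟨Pl l, inferInstance⟩
    have hweak : Tendsto Ql atTop (𝓝 Q) := by
      refine tendsto_iff_forall_lipschitz_integral_tendsto.2 fun f _ ⟨L, hL⟩ => ?_
      exact tendsto_integral_of_tendsto_dFM h (by positivity : (L : ℝ) + 1 ≠ 0)
        (hL.div_mem_fortetMourierClass hp)
    intro f hf ⟨C, hC⟩
    exact ProbabilityMeasure.tendsto_iff_forall_integral_tendsto.1 hweak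
      (BoundedContinuousFunction.ofNormedAddCommGroup f hf C hC)
  · exact tendsto_integral_of_tendsto_dFM h (by linarith : p ≠ 0) (growthWeight_div_mem hp)
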